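/- Let n ≥ 11 be an integer and let q be a prime power whose characteristic p satisfies p ≥ n. If q > exp(2^{2.77 n}), then 𝔽_q contains n consecutive primitive elements. -/

import Mathlib

open Finset

/-- An element `g` of a finite field is primitive if it generates the multiplicative
group of nonzero elements, i.e. every nonzero element is a power of `g`. -/
def IsPrimitiveElem {F : Type*} [Field F] (g : F) : Prop :=
  ∀ x : F, x ≠ 0 → ∃ k : ℕ, g ^ k = x

/-- The field `F` contains `n` consecutive distinct primitive elements: there is `g`
such that `g, g+1, …, g+n-1` are `n` distinct primitive elements. -/
def HasConsecutivePrimitives (F : Type*) [Field F] (n : ℕ) : Prop :=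
  ∃ g : F, (∀ k : ℕ, k < n → IsPrimitiveElem (g + (k : F))) ∧
    ∀ i : ℕ, i < n → ∀ j : ℕ, j < n → g + (i : F) = g + (j : F) → i = j

section ConsecutivePrimitives

open Polynomial

theorem linearIndependent_of_galois_eigenvectors {K E ι : Type*} [Field K] [Field E] [Algebra K E]
    [IsGalois K E] (t : ι → E) (ht : ∀ a, t a ≠ 0)
    (hσ : ∀ (σ : E ≃ₐ[K] E) (a : ι), σ (t a) / t a ∈ Set.range (algebraMap K E))
    (hne : ∀ a b, t a / t b ∈ Set.range (algebraMap K E) → a = b) :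
    LinearIndependent K t := by
  let χ : ι → ((E ≃ₐ[K] E) →* E) := fun a =>
    { toFun := fun σ => σ (t a) / t a
      map_one' := by simp [ht a]
      map_mul' := by
        intro σ τ
        obtain ⟨r, hr⟩ := hσ τ a
        have h1 : τ (t a) = algebraMap K E r * t a := by
          rw [hr]; field_simp [ht a]
        have h2 : (σ * τ) (t a) = algebraMap K E r * σ (t a) := by
          rw [AlgEquiv.mul_apply, h1, map_mul, AlgEquiv.commutes]
        rw [h2, h1]
        field_simp [ht a] }
  have hinj : Function.Injective χ := by
    intro a b hab
    apply hne
    rw [InfiniteGalois.mem_range_algebraMap_iff_fixed]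
    intro σ
    have h : σ (t a) / t a = σ (t b) / t b := DFunLike.congr_fun hab σ
    have hb : σ (t b) ≠ 0 := by simpa using ht b
    rw [map_div₀, div_eq_div_iff hb (ht b)]
    rw [div_eq_div_iff (ht a) (ht b)] at h
    linear_combination h
  have hli := (linearIndependent_monoidHom (E ≃ₐ[K] E) E).comp χ hinj
  rw [linearIndependent_iff'] at hli ⊢
  intro s g hg i hi
  have := hli s (fun a => algebraMap K E (g a) * t a) (by
    funext σ
    have h0 := congrArg σ hg
    simp only [map_sum, map_zero, Algebra.smul_def, map_mul, AlgEquiv.commutes] at h0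
    simp only [Finset.sum_apply, Pi.smul_apply, smul_eq_mul, Function.comp, Pi.zero_apply]
    rw [← h0]
    refine Finset.sum_congr rfl fun a _ => ?_
    change algebraMap K E (g a) * t a * (σ (t a) / t a) = _
    field_simp [ht a]) i hi
  simpa [ht i] using this

theorem mem_range_algebraMap_of_pow_eq_one {F E : Type*} [Field F] [Fintype F] [Field E]
    (f : F →+* E) {d : ℕ} (hd : d ∣ Fintype.card F - 1) {e : E} (he : e ^ d = 1) :
    e ∈ Set.range f := by
  have hq : 1 < Fintype.card F := Fintype.one_lt_card
  obtain ⟨m, hm⟩ := hd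
  have h1 : e ^ Fintype.card F = e := by
    have : Fintype.card F = d * m + 1 := by omega
    rw [this, pow_succ, pow_mul, he, one_pow, one_mul]
  have hp : ∏ a : F, (X - C a) = (X ^ Fintype.card F - X : F[X]) := by
    have := prod_multiset_X_sub_C_of_monic_of_roots_card_eq
      (p := (X ^ Fintype.card F - X : F[X]))
      (monic_X_pow_sub (by rw [degree_X]; exact_mod_cast hq))
      (by rw [FiniteField.roots_X_pow_card_sub_X, FiniteField.X_pow_card_sub_X_natDegree_eq F hq]
          rfl)
    rwa [FiniteField.roots_X_pow_card_sub_X] at this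
  have h2 := congrArg (eval₂ f e) hp
  rw [eval₂_finsetProd] at h2
  simp only [eval₂_sub, eval₂_X, eval₂_C, eval₂_pow, h1, sub_self] at h2
  obtain ⟨a, -, ha⟩ := Finset.prod_eq_zero_iff.mp h2
  exact ⟨a, (sub_eq_zero.mp ha).symm⟩

theorem linearIndependent_radicals {F K E κ : Type*} [Field F] [Fintype F] [Field K] [Field E]
    [Algebra K E] [IsGalois K E] (f : F →+* K) [Fintype κ] [DecidableEq κ] (d : κ → ℕ)
    (hd : ∀ i, d i ∣ Fintype.card F - 1) (T : κ → E) (c : κ → K) (hT0 : ∀ i, T i ≠ 0)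
    (hT : ∀ i, T i ^ d i = algebraMap K E (c i))
    (hne : ∀ (a b : ∀ i, ZMod (d i)) (r : K),
      ∏ i, c i ^ ((a i).val * ∏ j ∈ univ.erase i, d j) =
        r ^ (∏ j, d j) * ∏ i, c i ^ ((b i).val * ∏ j ∈ univ.erase i, d j) → a = b) :
    LinearIndependent K (fun a : (∀ i, ZMod (d i)) => ∏ i, T i ^ (a i).val) := by
  apply linearIndependent_of_galois_eigenvectors
  · intro a
    exact Finset.prod_ne_zero_iff.mpr fun i _ => pow_ne_zero _ (hT0 i)
  · intro σ a
    have h : ∀ i, ∃ r, algebraMap K E r = σ (T i) / T i := fun i => by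
      have h1 : (σ (T i) / T i) ^ d i = 1 := by
        rw [div_pow, ← map_pow, hT, AlgEquiv.commutes, ← hT]
        exact div_self (pow_ne_zero _ (hT0 i))
      obtain ⟨x, hx⟩ := mem_range_algebraMap_of_pow_eq_one ((algebraMap K E).comp f) (hd i) h1
      exact ⟨f x, hx⟩
    choose r hr using h
    refine ⟨∏ i, r i ^ (a i).val, ?_⟩
    simp only [map_prod, map_pow, hr, ← Finset.prod_div_distrib, div_pow]
  · rintro a b ⟨r, hr⟩
    apply hne a b r
    apply (algebraMap K E).injective
    have key : ∀ a : (∀ i, ZMod (d i)), algebraMap K E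
        (∏ i, c i ^ ((a i).val * ∏ j ∈ univ.erase i, d j)) =
        (∏ i, T i ^ (a i).val) ^ ∏ j, d j := by
      intro a
      rw [map_prod, ← Finset.prod_pow]
      refine Finset.prod_congr rfl fun i _ => ?_
      rw [map_pow, ← hT, ← pow_mul, ← pow_mul, ← Finset.mul_prod_erase univ d (Finset.mem_univ i)]
      congr 1; ring
    have hb : ∏ i, T i ^ (b i).val ≠ 0 :=
      Finset.prod_ne_zero_iff.mpr fun i _ => pow_ne_zero _ (hT0 i)
    rw [map_mul, key, key, map_pow, hr, div_pow, div_mul_cancel₀ _ (pow_ne_zero _ hb)]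

universe u

theorem rootMultiplicity_prod_pow {R κ : Type*} [CommRing R] [IsDomain R] (s : Finset κ)
    (f : κ → R[X]) (e : κ → ℕ) (hf : ∀ i, f i ≠ 0) (x : R) :
    rootMultiplicity x (∏ i ∈ s, f i ^ e i) = ∑ i ∈ s, e i * rootMultiplicity x (f i) := by
  classical
  simp only [← count_roots]
  rw [roots_prod _ _ (Finset.prod_ne_zero_iff.mpr fun i _ => pow_ne_zero _ (hf i)),
    Multiset.count_bind]
  simp only [roots_pow, Multiset.count_nsmul]
  rfl

theorem exists_kummer_extension {F : Type u} {κ : Type*} [Field F] [Fintype F] [Fintype κ] [DecidableEq κ]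
    (s : κ → F) (hs : Function.Injective s) (d : κ → ℕ) (hd : ∀ i, d i ∣ Fintype.card F - 1) :
    ∃ (E : Type u) (_ : Field E) (φ : F[X][X] →+* E) (T : κ → E), Function.Injective φ ∧
      (∀ i, φ (X + C (C (s i))) * T i ^ d i = φ (C (X + C (s i)))) ∧
      ∀ (t : Finset (∀ i, ZMod (d i))) (y : (∀ i, ZMod (d i)) → F[X][X]),
        ∑ a ∈ t, φ (y a) * ∏ i, T i ^ (a i).val = 0 → ∀ a ∈ t, y a = 0 := by
  let B := F[X][X]
  let K := FractionRing B
  let E := SeparableClosure K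
  let g : F →+* K := (algebraMap B K).comp (C.comp C)
  have hq : 1 < Fintype.card F := Fintype.one_lt_card
  have hdF : ∀ i, ((d i : ℕ) : F) ≠ 0 := by
    intro i h
    obtain ⟨m, hm⟩ := hd i
    have h1 : Fintype.card F = d i * m + 1 := by omega
    have h2 := FiniteField.cast_card_eq_zero F
    rw [h1] at h2
    push_cast at h2
    rw [h] at h2
    simp at h2
  have hd0 : ∀ i, d i ≠ 0 := fun i h => hdF i (by simp [h])
  have hdE : ∀ i, NeZero ((d i : ℕ) : E) := fun i => ⟨fun h => hdF i (by
    apply ((algebraMap K E).comp g).injective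
    rw [map_natCast, h, map_zero])⟩
  let u : κ → B := fun i => C (X + C (s i))
  let v : κ → B := fun i => X + C (C (s i))
  have hu : ∀ i, u i ≠ 0 := fun i => by
    exact C_ne_zero.mpr (X_add_C_ne_zero (s i))
  have hv : ∀ i, v i ≠ 0 := fun i => X_add_C_ne_zero _
  have hinj : Function.Injective (algebraMap B K) := IsFractionRing.injective B K
  have hu' : ∀ i, algebraMap B K (u i) ≠ 0 := fun i => by
    simpa using hu i
  have hv' : ∀ i, algebraMap B K (v i) ≠ 0 := fun i => by
    simpa using hv i
  let c : κ → K := fun i => algebraMap B K (u i) / algebraMap B K (v i)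
  have hc : ∀ i, c i ≠ 0 := fun i => div_ne_zero (hu' i) (hv' i)
  have hT : ∀ i, ∃ z : E, z ^ d i = algebraMap K E (c i) := fun i =>
    have := hdE i
    IsSepClosed.exists_pow_nat_eq _ _
  choose T hT using hT
  have hT0 : ∀ i, T i ≠ 0 := by
    intro i h
    have := hT i
    rw [h, zero_pow (hd0 i)] at this
    exact hc i (by simpa using this.symm)
  have hli := linearIndependent_radicals g d hd T c hT0 hT (by
    intro a b r hr
    funext i₀
    obtain ⟨x, y, hy, rfl⟩ := IsFractionRing.div_surjective (A := B) r
    have hy0 : y ≠ 0 := nonZeroDivisors.ne_zero hy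
    have hy' : algebraMap B K y ≠ 0 := by simpa using hy0
    set e : κ → ℕ := fun i => ∏ j ∈ univ.erase i, d j with he
    set D := ∏ j, d j with hD
    have hP : ∀ (w : κ → B), (∀ i, w i ≠ 0) → ∀ m : κ → ℕ,
        ∏ i, algebraMap B K (w i) ^ m i ≠ 0 := fun w hw m =>
      Finset.prod_ne_zero_iff.mpr fun i _ => pow_ne_zero _ (by simpa using hw i)
    have h1 : y ^ D * (∏ i, u i ^ ((a i).val * e i)) * ∏ i, v i ^ ((b i).val * e i) =
        x ^ D * (∏ i, u i ^ ((b i).val * e i)) * ∏ i, v i ^ ((a i).val * e i) := by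
      apply hinj
      simp only [map_mul, map_pow, map_prod]
      have hc' : ∀ m : κ → ℕ, ∏ i, c i ^ m i =
          (∏ i, algebraMap B K (u i) ^ m i) / ∏ i, algebraMap B K (v i) ^ m i := fun m => by
        simp only [c, div_pow, Finset.prod_div_distrib]
      rw [hc' (fun i => (a i).val * e i), hc' (fun i => (b i).val * e i), div_pow] at hr
      have n1 := hP v hv fun i => (a i).val * e i
      have n2 := hP v hv fun i => (b i).val * e i
      have n3 := pow_ne_zero D hy'
      rw [div_mul_div_comm, div_eq_div_iff n1 (mul_ne_zero n3 n2)] at hr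
      linear_combination hr
    have hP' : ∀ (w : κ → B), (∀ i, w i ≠ 0) → ∀ m : κ → ℕ,
        ∏ i, w i ^ m i ≠ 0 := fun w hw m =>
      Finset.prod_ne_zero_iff.mpr fun i _ => pow_ne_zero _ (hw i)
    have hL : y ^ D * (∏ i, u i ^ ((a i).val * e i)) * ∏ i, v i ^ ((b i).val * e i) ≠ 0 :=
      mul_ne_zero (mul_ne_zero (pow_ne_zero _ hy0) (hP' u hu _)) (hP' v hv _)
    have hR := hL
    rw [h1] at hR
    have hru : ∀ i, rootMultiplicity (C (-s i₀)) (u i) = 0 := fun i => rootMultiplicity_C _ _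
    have hrv : ∀ i, rootMultiplicity (C (-s i₀)) (v i) = if i = i₀ then 1 else 0 := by
      intro i
      have : v i = X - C (C (-s i)) := by simp [v]
      classical
      rw [this, rootMultiplicity_X_sub_C]
      simp [hs.eq_iff, eq_comm]
    have hpow : ∀ z : B, z ^ D ≠ 0 → rootMultiplicity (C (-s i₀)) (z ^ D) =
        D * rootMultiplicity (C (-s i₀)) z := fun z hz => by
      classical
      rw [← count_roots, ← count_roots, roots_pow, Multiset.count_nsmul]
    have h2 := congrArg (rootMultiplicity (C (-s i₀))) h1
    rw [rootMultiplicity_mul hL, rootMultiplicity_mul (left_ne_zero_of_mul hL),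
      rootMultiplicity_mul hR, rootMultiplicity_mul (left_ne_zero_of_mul hR),
      rootMultiplicity_prod_pow _ _ _ hu, rootMultiplicity_prod_pow _ _ _ hv,
      rootMultiplicity_prod_pow _ _ _ hu, rootMultiplicity_prod_pow _ _ _ hv,
      hpow _ (left_ne_zero_of_mul (left_ne_zero_of_mul hL)),
      hpow _ (left_ne_zero_of_mul (left_ne_zero_of_mul hR))] at h2
    simp only [hru, hrv, mul_zero, Finset.sum_const_zero, mul_ite, mul_one, Finset.sum_ite_eq',
      Finset.mem_univ, if_true, add_zero] at h2
    have hDe : D = d i₀ * e i₀ := (Finset.mul_prod_erase univ d (Finset.mem_univ i₀)).symm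
    have he0 : 0 < e i₀ := Nat.pos_of_ne_zero (Finset.prod_ne_zero_iff.mpr fun i _ => hd0 i)
    have h3 : d i₀ * rootMultiplicity (C (-s i₀)) y + (b i₀).val =
        d i₀ * rootMultiplicity (C (-s i₀)) x + (a i₀).val := by
      apply Nat.eq_of_mul_eq_mul_right he0
      rw [hDe] at h2
      linarith
    have := NeZero.mk (hd0 i₀)
    apply ZMod.val_injective
    have h4 := congrArg (· % d i₀) h3
    simpa [Nat.mod_eq_of_lt (ZMod.val_lt _)] using h4.symm)
  refine ⟨E, inferInstance, (algebraMap K E).comp (algebraMap B K), T,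
    (algebraMap K E).injective.comp hinj, ?_, ?_⟩
  · intro i
    rw [hT]
    simp only [RingHom.comp_apply, ← map_mul]
    congr 1
    exact mul_div_cancel₀ _ (hv' i)
  · intro t y hy a ha
    rw [linearIndependent_iff'] at hli
    have := hli t (fun a => algebraMap B K (y a)) (by
      simpa only [Algebra.smul_def, RingHom.comp_apply] using hy) a ha
    simpa using this

/-- The structure constants of the monomials `∏ i, T i ^ a i`, where `v i * T i ^ d i = u i`. -/
def carryCoeff {κ B : Type*} [Fintype κ] [CommMonoid B] (d : κ → ℕ) (u v : κ → B)
    (a b : ∀ i, ZMod (d i)) : B :=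
  ∏ i, if (a i).val + (b i).val < d i then v i else u i

theorem carryCoeff_spec {κ B R : Type*} [Fintype κ] [CommRing B] [CommRing R] (φ : B →+* R)
    (d : κ → ℕ) [∀ i, NeZero (d i)] (u v : κ → B) (T : κ → R)
    (hT : ∀ i, φ (v i) * T i ^ d i = φ (u i)) (a b : ∀ i, ZMod (d i)) :
    φ (∏ i, v i) * (∏ i, T i ^ (a i).val) * ∏ i, T i ^ (b i).val =
      φ (carryCoeff d u v a b) * ∏ i, T i ^ ((a + b) i).val := by
  simp only [carryCoeff, map_prod, ← Finset.prod_mul_distrib]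
  refine Finset.prod_congr rfl fun i _ => ?_
  split_ifs with h
  · rw [Pi.add_apply, ZMod.val_add_of_lt h, pow_add, mul_assoc]
  · rw [Pi.add_apply, mul_assoc, ← pow_add, ZMod.val_add_val_of_le (not_lt.mp h), pow_add, ← hT]
    ring

theorem eval₂_expand_injective {F : Type*} [Field F] {q : ℕ} (hq : 0 < q) (P : F[X][X])
    (hP : P.natDegree < q) (h : eval₂ (expand F q : F[X] →+* F[X]) X P = 0) : P = 0 := by
  ext e m
  rw [coeff_zero]
  by_cases he : e < q
  · rw [eval₂_eq_sum_range' _ hP] at h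
    have h1 := congrArg (fun Q => coeff Q (m * q + e)) h
    simp only [finsetSum_coeff, coeff_zero] at h1
    rw [Finset.sum_eq_single e] at h1
    · rw [coeff_mul_X_pow, RingHom.coe_coe, coeff_expand_mul hq] at h1
      exact h1
    · intro b hb hbe
      have hb := Finset.mem_range.mp hb
      rw [coeff_mul_X_pow']
      split_ifs with hle
      · rw [RingHom.coe_coe, coeff_expand hq, if_neg]
        rintro ⟨w, hw⟩
        have h2 : m * q + e = q * w + b := by omega
        have h3 := congrArg (· % q) h2
        simp only [Nat.mul_add_mod, Nat.mul_add_mod_self_right, Nat.mod_eq_of_lt he, Nat.mod_eq_of_lt hb] at h3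
        exact hbe h3.symm
      · rfl
    · intro h'
      exact absurd (Finset.mem_range.mpr he) h'
  · rw [coeff_eq_zero_of_natDegree_lt (hP.trans_le (not_lt.mp he)), coeff_zero]

theorem stepanov_nonvanishing {F : Type u} {κ : Type*} [Field F] [Fintype F] [Fintype κ]
    [DecidableEq κ] (s : κ → F) (hs : Function.Injective s) (d : κ → ℕ) [∀ i, NeZero (d i)]
    (hd : ∀ i, d i ∣ Fintype.card F - 1) (A : ℕ)
    (hA : (∏ i, d i) * (A + Fintype.card κ) < Fintype.card F)
    (k : (∀ i, ZMod (d i)) → F[X][X]) (hk : ∀ a, (k a).natDegree ≤ A)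
    (h0 : ∑ a, eval₂ (expand F (Fintype.card F) : F[X] →+* F[X]) X (k a) *
      ∏ i, ((X + C (s i)) ^ ((Fintype.card F - 1) / d i)) ^ (a i).val = 0) : k = 0 := by
  have hq : 1 < Fintype.card F := Fintype.one_lt_card
  set φ : F[X][X] →+* F[X] := eval₂RingHom (expand F (Fintype.card F) : F[X] →+* F[X]) X with hφ
  set u : κ → F[X][X] := fun i => C (X + C (s i)) with hu
  set v : κ → F[X][X] := fun i => X + C (C (s i)) with hv
  set H : κ → F[X] := fun i => (X + C (s i)) ^ ((Fintype.card F - 1) / d i) with hH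
  have hφH : ∀ i, φ (v i) * H i ^ d i = φ (u i) := by
    intro i
    have h1 : φ (v i) = X + C (s i) := by
      simp only [hφ, hv, coe_eval₂RingHom, eval₂_X, eval₂_C, RingHom.coe_coe, expand_C, map_add]
    have h2 : φ (u i) = (X + C (s i)) ^ Fintype.card F := by
      rw [← FiniteField.expand_card]
      simp only [hφ, hu, coe_eval₂RingHom, eval₂_C, RingHom.coe_coe]
    rw [h1, h2, hH, ← pow_mul, Nat.div_mul_cancel (hd i), ← pow_succ', Nat.sub_add_cancel hq.le]
  let M : Matrix (∀ i, ZMod (d i)) (∀ i, ZMod (d i)) F[X][X] := Matrix.of fun a c =>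
    k (c - a) * carryCoeff d u v a (c - a)
  have hM : ∀ {R : Type u} [CommRing R] (ψ : F[X][X] →+* R) (T : κ → R),
      (∀ i, ψ (v i) * T i ^ d i = ψ (u i)) → ∀ a,
      ∑ c, ψ (M a c) * ∏ i, T i ^ (c i).val = ψ (∏ i, v i) * (∏ i, T i ^ (a i).val) *
        ∑ b, ψ (k b) * ∏ i, T i ^ (b i).val := by
    intro R _ ψ T hT a
    rw [Finset.mul_sum, ← Equiv.sum_comp (Equiv.addLeft a)]
    refine Finset.sum_congr rfl fun b _ => ?_
    simp only [Equiv.coe_addLeft, M, Matrix.of_apply, add_sub_cancel_left, map_mul]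
    have := carryCoeff_spec ψ d u v T hT a b
    linear_combination -ψ (k b) * this
  have hdet0 : M.det = 0 := by
    apply eval₂_expand_injective (q := Fintype.card F) (by omega)
    · refine lt_of_le_of_lt ?_ hA
      rw [Matrix.det_apply]
      apply natDegree_sum_le_of_forall_le
      intro σ _
      rw [Units.smul_def]
      refine (natDegree_smul_le _ _).trans ?_
      refine (natDegree_prod_le _ _).trans ?_
      have hcard : Fintype.card (∀ i, ZMod (d i)) = ∏ i, d i := by
        simp [Fintype.card_pi, ZMod.card]
      rw [← hcard, ← smul_eq_mul, ← Finset.card_univ, ← Finset.sum_const]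
      refine Finset.sum_le_sum fun a _ => ?_
      refine natDegree_mul_le.trans (add_le_add (hk _) ?_)
      refine (natDegree_prod_le _ _).trans ?_
      rw [← Finset.card_univ, Finset.card_eq_sum_ones]
      refine Finset.sum_le_sum fun i _ => ?_
      split_ifs
      · exact (natDegree_X_add_C _).le
      · exact (natDegree_C _).le.trans zero_le_one
    · change φ M.det = 0
      rw [RingHom.map_det, ← Matrix.exists_mulVec_eq_zero_iff]
      refine ⟨fun c => ∏ i, H i ^ (c i).val, ?_, ?_⟩
      · intro h
        have := congrFun h 0
        simp only [Pi.zero_apply] at this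
        exact Finset.prod_ne_zero_iff.mpr
          (fun i _ => pow_ne_zero _ (pow_ne_zero _ (X_add_C_ne_zero _))) this
      · funext a
        have := hM φ H hφH a
        rw [show ∑ b, φ (k b) * ∏ i, H i ^ (b i).val = 0 from h0, mul_zero] at this
        exact this
  obtain ⟨E, _, ψ, T, hψ, hT, hli⟩ := exists_kummer_extension s hs d hd
  obtain ⟨y, hy0, hy⟩ := Matrix.exists_vecMul_eq_zero_iff.mpr hdet0
  have h1 : ψ (∏ i, v i) * (∑ a, ψ (y a) * ∏ i, T i ^ (a i).val) *
      (∑ b, ψ (k b) * ∏ i, T i ^ (b i).val) = 0 := by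
    have h2 : ∑ a, ψ (y a) * ∑ c, ψ (M a c) * ∏ i, T i ^ (c i).val = 0 := by
      simp only [Finset.mul_sum, ← mul_assoc, ← map_mul]
      rw [Finset.sum_comm]
      refine Finset.sum_eq_zero fun c _ => ?_
      rw [← Finset.sum_mul, ← map_sum]
      have := congrFun hy c
      simp only [Matrix.vecMul, dotProduct, Pi.zero_apply] at this
      rw [this, map_zero, zero_mul]
    rw [← h2, Finset.mul_sum (a := ψ (∏ i, v i)), Finset.sum_mul]
    refine Finset.sum_congr rfl fun a _ => ?_
    rw [hM ψ T hT a]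
    ring
  rcases mul_eq_zero.mp h1 with h2 | h2
  · rcases mul_eq_zero.mp h2 with h3 | h3
    · rw [map_eq_zero_iff ψ hψ, Finset.prod_eq_zero_iff] at h3
      obtain ⟨i, -, hi⟩ := h3
      exact absurd hi (X_add_C_ne_zero _)
    · exact absurd (funext fun a => hli univ y h3 a (Finset.mem_univ a)) hy0
  · exact funext fun a => hli univ k h2 a (Finset.mem_univ a)

theorem exists_ne_zero_mulVec_eq_zero {F m n : Type*} [Field F] [Fintype m] [Fintype n]
    (M : Matrix m n F) (h : Fintype.card m < Fintype.card n) : ∃ y ≠ 0, M.mulVec y = 0 := by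
  have := LinearMap.ker_ne_bot_of_finrank_lt (f := M.mulVecLin) (by simpa using h)
  obtain ⟨y, hy, hy0⟩ := Submodule.exists_mem_ne_zero_of_ne_bot this
  exact ⟨y, hy0, by simpa using hy⟩

/-- The coefficient of `X ^ l` in `P` has degree at most `w + n * l`. -/
def HasWeight {F : Type*} [Field F] (n w : ℕ) (P : F[X][X]) : Prop :=
  ∀ l, (P.coeff l).natDegree ≤ w + n * l

namespace HasWeight

variable {F : Type*} [Field F] {n w w' : ℕ} {P Q : F[X][X]}

theorem mul (hP : HasWeight n w P) (hQ : HasWeight n w' Q) : HasWeight n (w + w') (P * Q) := by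
  intro l
  rw [coeff_mul]
  apply natDegree_sum_le_of_forall_le
  rintro ⟨i, j⟩ hij
  have hij := HasAntidiagonal.mem_antidiagonal.mp hij
  refine natDegree_mul_le.trans ((add_le_add (hP i) (hQ j)).trans (le_of_eq ?_))
  simp only at hij ⊢
  rw [← hij]
  ring

theorem one : HasWeight n 0 (1 : F[X][X]) := by
  intro l
  rw [coeff_one]
  split_ifs <;> simp

theorem pow (hP : HasWeight n w P) (m : ℕ) : HasWeight n (m * w) (P ^ m) := by
  induction m with
  | zero => simpa using one
  | succ m ih => simpa [pow_succ, add_mul] using ih.mul hP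

theorem prod {κ : Type*} (t : Finset κ) (f : κ → F[X][X]) (hf : ∀ i ∈ t, HasWeight n 0 (f i)) :
    HasWeight n 0 (∏ i ∈ t, f i) := by
  classical
  induction t using Finset.induction_on with
  | empty => simpa using one
  | insert a t ha ih =>
    rw [Finset.prod_insert ha]
    simpa using (hf a (Finset.mem_insert_self a t)).mul
      (ih fun i hi => hf i (Finset.mem_insert_of_mem hi))

theorem C_add_X_mul_C {a b : F[X]} (ha : a.natDegree ≤ w) (hb : b.natDegree ≤ w + n) :
    HasWeight n w (C a + X * C b) := by
  intro l
  rcases l with _ | _ | l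
  · simpa [coeff_C] using ha
  · simpa [coeff_C, coeff_X_mul] using hb
  · simp

theorem const {a : F[X]} (ha : a.natDegree ≤ w) : HasWeight n w (C a) := by
  simpa using C_add_X_mul_C (n := n) (b := 0) ha (by simp)

end HasWeight

theorem pow_X_sub_C_dvd_of_comp {F : Type*} [Field F] {P : F[X]} {x w : F} (hw : w ≠ 0) {M : ℕ}
    (h : X ^ M ∣ P.comp (C x + X * C w)) : (X - C x) ^ M ∣ P := by
  obtain ⟨Q, hQ⟩ := h
  have h1 := congrArg (fun R => R.comp ((X - C x) * C w⁻¹)) hQ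
  have h2 : (C x + X * C w).comp ((X - C x) * C w⁻¹) = X := by
    simp only [add_comp, mul_comp, C_comp, X_comp]
    rw [mul_assoc, ← C_mul, inv_mul_cancel₀ hw]
    simp
  simp only [comp_assoc, h2, comp_X, mul_comp, pow_comp, X_comp, mul_pow] at h1
  rw [h1, mul_assoc]
  exact dvd_mul_right _ _

theorem X_pow_dvd_comp_sub {F : Type*} [Field F] [Fintype F] (x w : F) (j M : ℕ)
    (hM : M ≤ Fintype.card F) :
    X ^ M ∣ ((C x + X * C w) ^ (Fintype.card F * j) - C (x ^ j) : F[X]) := by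
  rw [pow_mul, ← FiniteField.expand_card, C_pow]
  refine Dvd.dvd.trans ?_ (sub_dvd_pow_sub_pow _ _ j)
  simp only [map_add, expand_C, map_mul, expand_X, add_sub_cancel_left]
  exact Dvd.dvd.mul_right (pow_dvd_pow _ hM) _

section Stepanov

variable {F : Type u} {κ : Type*} [Field F] [Fintype F] [Fintype κ] [DecidableEq κ]

/-- The product of the factors `X + s j` with `j ≠ i`. -/
noncomputable def cofactor (s : κ → F) (i : κ) : F[X] := ∏ j ∈ univ.erase i, (X + C (s j))

/-- The local expansion of `X ^ e * ∏ i, h i ^ a i * X ^ (q * j)` at a point where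
`h i = (X + s i) ^ m i` takes the value `c i`. -/
noncomputable def localExpansion (s : κ → F) (c : κ → F) (m : κ → ℕ) (e : ℕ) (a : κ → ℕ) (j : ℕ) : F[X][X] :=
  C (C (∏ i, c i ^ a i) * X ^ j) * (C X + X * C (∏ i, (X + C (s i)))) ^ e *
    ∏ i, (C 1 + X * C (cofactor s i)) ^ (m i * a i)

omit [Fintype F] in
theorem hasWeight_localExpansion (s : κ → F) (c : κ → F) (m : κ → ℕ) (e : ℕ) (a : κ → ℕ) (j : ℕ) :
    HasWeight (Fintype.card κ) (j + e) (localExpansion s c m e a j) := by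
  have hprod : ∀ t : Finset κ, (∏ i ∈ t, (X + C (s i))).natDegree ≤ Fintype.card κ := fun t => by
    refine (natDegree_prod_le _ _).trans ?_
    simp only [natDegree_X_add_C, Finset.sum_const, smul_eq_mul, mul_one]
    exact Finset.card_le_univ t
  have h1 : HasWeight (Fintype.card κ) j (C (C (∏ i, c i ^ a i) * X ^ j) : F[X][X]) :=
    HasWeight.const (natDegree_C_mul_X_pow_le _ _)
  have h2 : HasWeight (Fintype.card κ) 1 (C X + X * C (∏ i, (X + C (s i))) : F[X][X]) :=
    HasWeight.C_add_X_mul_C natDegree_X.le ((hprod _).trans (by omega))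
  have h3 : HasWeight (Fintype.card κ) 0
      (∏ i, (C 1 + X * C (cofactor s i)) ^ (m i * a i) : F[X][X]) := by
    apply HasWeight.prod
    intro i _
    have := (HasWeight.C_add_X_mul_C (n := Fintype.card κ) (w := 0) (a := (1 : F[X]))
      (b := cofactor s i) (by simp) (by simpa [cofactor] using hprod (univ.erase i))).pow (m i * a i)
    simpa using this
  simpa [localExpansion] using (h1.mul (h2.pow e)).mul h3

theorem X_pow_dvd_comp_sub_localExpansion (s : κ → F) (c : κ → F) (m : κ → ℕ) (e : ℕ) (a : κ → ℕ)
    (j M : ℕ) (hM : M ≤ Fintype.card F) (x : F) (hx : ∀ i, (x + s i) ^ m i = c i) :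
    X ^ M ∣ (X ^ e * X ^ (Fintype.card F * j) * ∏ i, ((X + C (s i)) ^ m i) ^ a i : F[X]).comp
      (C x + X * C (∏ i, (x + s i))) -
      (localExpansion s c m e a j).map (evalRingHom x) := by
  obtain ⟨R, hR⟩ := X_pow_dvd_comp_sub x (∏ i, (x + s i)) j M hM
  have h1 : (localExpansion s c m e a j).map (evalRingHom x) =
      C (x ^ j) * (C x + X * C (∏ i, (x + s i))) ^ e * ∏ i,
        (C (c i) ^ a i * (C 1 + X * C ((cofactor s i).eval x)) ^ (m i * a i)) := by
    rw [Finset.prod_mul_distrib]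
    simp only [localExpansion, Polynomial.map_mul, Polynomial.map_pow, Polynomial.map_add, map_C,
      map_X, Polynomial.map_prod, coe_evalRingHom, eval_C, eval_X,
      eval_add, eval_one, C_mul, map_prod, C_pow]
    ring
  have h2 : (X ^ e * X ^ (Fintype.card F * j) * ∏ i, ((X + C (s i)) ^ m i) ^ a i : F[X]).comp
      (C x + X * C (∏ i, (x + s i))) =
      (C x + X * C (∏ i, (x + s i))) ^ (Fintype.card F * j) *
        (C x + X * C (∏ i, (x + s i))) ^ e * ∏ i,
        (C (c i) ^ a i * (C 1 + X * C ((cofactor s i).eval x)) ^ (m i * a i)) := by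
    simp only [mul_comp, pow_comp, X_comp, Polynomial.prod_comp, add_comp, C_comp]
    rw [mul_comm ((C x + X * C (∏ i, (x + s i))) ^ e)]
    congr 1
    refine Finset.prod_congr rfl fun i _ => ?_
    rw [← hx, C_pow, ← pow_mul, ← pow_mul, ← mul_pow]
    congr 1
    have h3 : ∏ i, (x + s i) = (x + s i) * (cofactor s i).eval x := by
      simp only [cofactor, eval_prod, eval_add, eval_X, eval_C]
      exact (Finset.mul_prod_erase _ _ (Finset.mem_univ i)).symm
    rw [h3]
    simp only [C_mul, C_add, C_1]
    ring
  rw [h1, h2, ← sub_mul, ← sub_mul, hR, mul_assoc, mul_assoc]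
  exact dvd_mul_right _ _

theorem card_mul_le_natDegree_of_pow_dvd {F : Type*} [Field F] (Z : Finset F) (M : ℕ) (P : F[X])
    (hP : P ≠ 0) (h : ∀ x ∈ Z, (X - C x) ^ M ∣ P) : Z.card * M ≤ P.natDegree := by
  have h1 : ∏ x ∈ Z, (X - C x) ^ M ∣ P := by
    refine Finset.prod_dvd_of_coprime ?_ h
    intro x _ y _ hxy
    exact (isCoprime_X_sub_C_of_isUnit_sub (sub_ne_zero.mpr hxy).isUnit).pow
  have h2 := natDegree_le_of_dvd h1 hP
  rw [natDegree_prod _ _ fun x _ => pow_ne_zero _ (X_sub_C_ne_zero x)] at h2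
  simpa [natDegree_pow] using h2

theorem stepanov_card_le (s : κ → F) (hs : Function.Injective s) (d : κ → ℕ) [∀ i, NeZero (d i)]
    (hd : ∀ i, d i ∣ Fintype.card F - 1) (c : κ → F) (hc : ∀ i, c i ≠ 0) (K : ℕ) (hK : 0 < K)
    (hq : (∏ i, d i) * ((Fintype.card κ + 1) * ((∏ i, d i) * K) ^ 2 + Fintype.card κ) <
      Fintype.card F) (Z : Finset F)
    (hZ : ∀ x ∈ Z, ∀ i, (x + s i) ^ ((Fintype.card F - 1) / d i) = c i) :
    Z.card * ((∏ i, d i) * K - 1) ≤ Fintype.card F * (K + Fintype.card κ) := by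
  classical
  have hq1 : 1 < Fintype.card F := Fintype.one_lt_card
  set q := Fintype.card F with hqdef
  set n := Fintype.card κ with hn
  set D := ∏ i, d i with hD
  have hD0 : 0 < D := Finset.prod_pos fun i _ => Nat.pos_of_ne_zero (NeZero.ne _)
  set A := (n + 1) * (D * K) ^ 2 with hA
  set M := D * K - 1 with hM
  set m : κ → ℕ := fun i => (q - 1) / d i with hm
  have hP0 : 0 < D * K := Nat.mul_pos hD0 hK
  have hKP : K ≤ D * K := Nat.le_mul_of_pos_left K hD0
  have hMP : D * K = M + 1 := by omega
  have hAq : A ≤ q := by nlinarith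
  have hMq : M ≤ q := by nlinarith
  let I := Fin A × (∀ i, ZMod (d i)) × Fin K
  let Ψ : I → F[X][X] := fun t =>
    localExpansion s c m t.1 (fun i => (t.2.1 i).val) t.2.2
  let G : I → F[X] := fun t =>
    X ^ (t.1 : ℕ) * X ^ (q * (t.2.2 : ℕ)) * ∏ i, ((X + C (s i)) ^ m i) ^ (t.2.1 i).val
  have hcount : Fintype.card (Fin M × Fin (A + K + n * M)) < Fintype.card I := by
    simp only [I, Fintype.card_prod, Fintype.card_fin, Fintype.card_pi, ZMod.card]
    rw [← hD, hMP, hA, hMP]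
    nlinarith
  obtain ⟨y, hy0, hy⟩ := exists_ne_zero_mulVec_eq_zero
    (Matrix.of fun (r : Fin M × Fin (A + K + n * M)) (t : I) =>
      ((Ψ t).coeff r.1).coeff r.2) hcount
  have hlow : ∀ l < M, ∑ t, C (y t) * (Ψ t).coeff l = 0 := by
    intro l hl
    ext b
    rw [coeff_zero, finsetSum_coeff]
    simp only [coeff_C_mul]
    by_cases hb : b < A + K + n * M
    · have := congrFun hy (⟨l, hl⟩, ⟨b, hb⟩)
      simpa [Matrix.mulVec, dotProduct, mul_comm] using this
    · refine Finset.sum_eq_zero fun t _ => ?_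
      rw [coeff_eq_zero_of_natDegree_lt, mul_zero]
      refine (hasWeight_localExpansion s c m _ _ _ l).trans_lt ?_
      have h1 := t.1.2
      have h2 := t.2.2.2
      have h3 : Fintype.card κ * l ≤ n * M := Nat.mul_le_mul_left n hl.le
      omega
  have hΦ0 : ∑ t, C (y t) * G t ≠ 0 := by
    intro h
    apply hy0
    let k : (∀ i, ZMod (d i)) → F[X][X] := fun a =>
      ∑ e : Fin A, monomial (e : ℕ) (∑ j : Fin K, monomial (j : ℕ) (y (e, a, j)))
    have hk0 : k = 0 := by
      apply stepanov_nonvanishing s hs d hd A hq k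
      · intro a
        refine natDegree_sum_le_of_forall_le _ _ fun e _ => ?_
        exact (natDegree_monomial_le _).trans e.2.le
      · rw [← h]
        simp only [k, I, Fintype.sum_prod_type, eval₂_finsetSum, eval₂_monomial, map_sum,
          Finset.sum_mul]
        rw [Finset.sum_comm]
        refine Finset.sum_congr rfl fun e _ => Finset.sum_congr rfl fun a _ =>
          Finset.sum_congr rfl fun j _ => ?_
        simp only [RingHom.coe_coe, expand_monomial, G]
        rw [← C_mul_X_pow_eq_monomial, mul_comm (j : ℕ)]
        ring
    funext ⟨e, a, j⟩
    have h1 := congrArg (fun P : F[X][X] => (P.coeff e).coeff j) (congrFun hk0 a)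
    simpa [k, finsetSum_coeff, coeff_monomial, Fin.val_inj] using h1
  have hdeg : (∑ t, C (y t) * G t).natDegree ≤ q * (K + n) := by
    refine natDegree_sum_le_of_forall_le _ _ fun t _ => ?_
    refine (natDegree_C_mul_le _ _).trans ?_
    refine natDegree_mul_le.trans ?_
    rw [← pow_add]
    refine (add_le_add (natDegree_X_pow_le _) (natDegree_prod_le _ _)).trans ?_
    have h1 := t.1.2
    have h2 : q * (t.2.2 : ℕ) + q ≤ q * K := by
      have := t.2.2.2
      nlinarith
    have h3 : ∑ i, (((X + C (s i) : F[X]) ^ m i) ^ (t.2.1 i).val).natDegree ≤ n * q := by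
      rw [hn, ← Finset.card_univ, ← smul_eq_mul, ← Finset.sum_const]
      refine Finset.sum_le_sum fun i _ => ?_
      rw [← pow_mul, natDegree_pow, natDegree_X_add_C, mul_one]
      refine (Nat.mul_le_mul_left _ (ZMod.val_lt (t.2.1 i)).le).trans ?_
      rw [hm, Nat.div_mul_cancel (hd i)]
      omega
    nlinarith
  refine (card_mul_le_natDegree_of_pow_dvd Z M _ hΦ0 fun x hx => ?_).trans hdeg
  have hx' := hZ x hx
  have hxs : ∏ i, (x + s i) ≠ 0 := by
    refine Finset.prod_ne_zero_iff.mpr fun i _ h0 => hc i ?_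
    rw [← hx' i, h0, zero_pow]
    exact (Nat.div_pos (Nat.le_of_dvd (by omega) (hd i)) (Nat.pos_of_ne_zero (NeZero.ne _))).ne'
  apply pow_X_sub_C_dvd_of_comp hxs
  have h1 : X ^ M ∣ ∑ t, C (y t) * (Ψ t).map (evalRingHom x) := by
    rw [X_pow_dvd_iff]
    intro l hl
    rw [finsetSum_coeff]
    have := congrArg (evalRingHom x) (hlow l hl)
    simpa [map_sum, eval_finsetSum] using this
  have h2 : X ^ M ∣ ∑ t, C (y t) * ((G t).comp (C x + X * C (∏ i, (x + s i))) -
      (Ψ t).map (evalRingHom x)) :=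
    Finset.dvd_sum fun t _ => Dvd.dvd.mul_left
      (X_pow_dvd_comp_sub_localExpansion s c m _ _ _ M hMq x hx') _
  have h3 : (∑ t, C (y t) * G t).comp (C x + X * C (∏ i, (x + s i))) =
      ∑ t, C (y t) * ((G t).comp (C x + X * C (∏ i, (x + s i))) -
        (Ψ t).map (evalRingHom x)) + ∑ t, C (y t) * (Ψ t).map (evalRingHom x) := by
    rw [← Finset.sum_add_distrib, Polynomial.sum_comp]
    refine Finset.sum_congr rfl fun t _ => ?_
    rw [mul_comp, C_comp]
    ring
  rw [h3]
  exact dvd_add h2 h1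

end Stepanov

section Equidistribution

variable {F : Type u} {κ : Type*} [Field F] [Fintype F] [Fintype κ] [DecidableEq κ]

theorem abs_card_sub_le [DecidableEq F] (s : κ → F) (hs : Function.Injective s) (d : κ → ℕ)
    (hd0 : ∀ i, d i ≠ 0) (hd : ∀ i, d i ∣ Fintype.card F - 1) (K : ℕ) (hK : 2 ≤ K)
    (hq : (∏ i, d i) * ((Fintype.card κ + 1) * ((∏ i, d i) * K) ^ 2 + Fintype.card κ) <
      Fintype.card F) :
    |((univ.filter fun x : F => ∀ i, (x + s i) ^ ((Fintype.card F - 1) / d i) = 1).card : ℝ) -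
        Fintype.card F * (∏ i, (d i : ℝ))⁻¹| ≤
      Fintype.card κ + 2 * (Fintype.card κ + 1) * Fintype.card F / K := by
  have (i : κ) : NeZero (d i) := ⟨hd0 i⟩
  let Z : (κ → F) → Finset F := fun c =>
    univ.filter fun x : F => ∀ i, (x + s i) ^ ((Fintype.card F - 1) / d i) = c i
  change |((Z fun _ => 1).card : ℝ) - _| ≤ _
  have hD1 : 1 ≤ ∏ i, d i := Finset.prod_pos fun i _ => Nat.pos_of_ne_zero (hd0 i)
  have hst (c : κ → F) (hc : ∀ i, c i ≠ 0) := stepanov_card_le s hs d hd c hc K (by omega) hq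
    (Z c) fun x hx => (mem_filter.mp hx).2
  have hcover : Fintype.card F ≤
      Fintype.card κ + ∑ c ∈ Fintype.piFinset fun i => nthRootsFinset (d i) (1 : F), (Z c).card := by
    have hsub : (univ : Finset F) ⊆ (univ.image fun i => -s i) ∪
        (Fintype.piFinset fun i => nthRootsFinset (d i) (1 : F)).biUnion Z := by
      intro x _
      by_cases h : ∃ i, x + s i = 0
      · obtain ⟨i, hi⟩ := h
        exact mem_union_left _ (mem_image.mpr ⟨i, mem_univ _, (eq_neg_of_add_eq_zero_left hi).symm⟩)
      · push Not at h
        refine mem_union_right _ (mem_biUnion.mpr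
          ⟨fun i => (x + s i) ^ ((Fintype.card F - 1) / d i), ?_, by simp [Z]⟩)
        refine Fintype.mem_piFinset.mpr fun i => ?_
        rw [mem_nthRootsFinset (Nat.pos_of_ne_zero (hd0 i)), ← pow_mul, Nat.div_mul_cancel (hd i),
          FiniteField.pow_card_sub_one_eq_one _ (h i)]
    calc Fintype.card F = (univ : Finset F).card := rfl
      _ ≤ _ := card_le_card hsub
      _ ≤ _ := card_union_le _ _
      _ ≤ _ := add_le_add card_image_le card_biUnion_le
  have hnum : (Fintype.piFinset fun i => nthRootsFinset (d i) (1 : F)).card ≤ ∏ i, d i := by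
    rw [Fintype.card_piFinset]
    refine Finset.prod_le_prod' fun i _ => ?_
    classical
    rw [nthRootsFinset_def]
    exact (Multiset.toFinset_card_le _).trans (card_nthRoots _ _)
  have hone : (fun _ => 1) ∈ Fintype.piFinset fun i => nthRootsFinset (d i) (1 : F) :=
    Fintype.mem_piFinset.mpr fun i => by
      rw [mem_nthRootsFinset (Nat.pos_of_ne_zero (hd0 i)), one_pow]
  rw [← Nat.cast_prod]
  set D := ∏ i, d i
  set n := Fintype.card κ
  set q := Fintype.card F
  have hDR : (1 : ℝ) ≤ D := by exact_mod_cast hD1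
  have hKR : (2 : ℝ) ≤ K := by exact_mod_cast hK
  set B : ℝ := q * (D : ℝ)⁻¹ + 2 * (n + 1) * q / (D * K) with hB
  have hZB (c : κ → F) (hc : ∀ i, c i ≠ 0) : ((Z c).card : ℝ) ≤ B := by
    have h1 := hst c hc
    have h2 : 1 ≤ D * K := Nat.mul_pos hD1 (by omega)
    have h3 : ((Z c).card : ℝ) * (D * K - 1) ≤ q * (K + n) := by
      have : (((Z c).card * (D * K - 1) : ℕ) : ℝ) ≤ ((q * (K + n) : ℕ) : ℝ) := by exact_mod_cast h1
      push_cast [Nat.cast_sub h2] at this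
      exact this
    have h4 : (0 : ℝ) < D * K - 1 := by nlinarith
    have h5 : (q : ℝ) * (K + n) ≤ B * (D * K - 1) := by
      have h6 : B * (D * K - 1) - q * (K + n) =
          q * ((D * K - 1) * (K + 2 * (n + 1)) - (K + n) * (D * K)) / (D * K) := by
        rw [hB]
        field_simp
      have h7 : 0 ≤ B * (D * K - 1) - q * (K + n) := by
        rw [h6]
        have : (0 : ℝ) ≤ (D * K - 1) * (K + 2 * (n + 1)) - (K + n) * (D * K) := by
          have hn0 : (0 : ℝ) ≤ n := Nat.cast_nonneg n
          have hDK : (K : ℝ) ≤ D * K := by nlinarith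
          nlinarith
        positivity
      linarith
    exact le_of_mul_le_mul_right (h3.trans h5) h4
  have hB0 : 0 ≤ B := by positivity
  have hE1 : B ≤ q * (D : ℝ)⁻¹ + 2 * (n + 1) * q / K := by
    rw [hB]
    gcongr
    nlinarith
  have hDB : (D : ℝ) * B = q + 2 * (n + 1) * q / K := by
    rw [hB]
    field_simp
  rw [abs_le]
  constructor
  · have hc2 : (q : ℝ) ≤ n + ((Z fun _ => 1).card + (D - 1) * B) := by
      rw [← Finset.add_sum_erase _ _ hone] at hcover
      have h1 : ((∑ c ∈ (Fintype.piFinset fun i => nthRootsFinset (d i) (1 : F)).erase fun _ => 1,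
          (Z c).card : ℕ) : ℝ) ≤ (D - 1) * B := by
        push_cast
        refine (Finset.sum_le_card_nsmul _ _ B fun c hc => hZB c fun i h0 => ?_).trans ?_
        · have := (Fintype.mem_piFinset.mp (mem_of_mem_erase hc)) i
          rw [mem_nthRootsFinset (Nat.pos_of_ne_zero (hd0 i)), h0, zero_pow (hd0 i)] at this
          exact zero_ne_one this
        · rw [card_erase_of_mem hone, nsmul_eq_mul]
          refine mul_le_mul_of_nonneg_right ?_ hB0
          have := (Nat.cast_le (α := ℝ)).mpr (Nat.sub_le_sub_right hnum 1)
          rwa [Nat.cast_sub hD1, Nat.cast_one] at this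
      have h2 : (q : ℝ) ≤ n + ((Z fun _ => 1).card + ((∑ c ∈ (Fintype.piFinset fun i =>
          nthRootsFinset (d i) (1 : F)).erase fun _ => 1, (Z c).card : ℕ) : ℝ)) := by
        exact_mod_cast hcover
      linarith
    have hB1 : q * (D : ℝ)⁻¹ ≤ B := le_add_of_nonneg_right (by positivity)
    linarith
  · have := hZB (fun _ => 1) fun _ => one_ne_zero
    linarith [(Nat.cast_nonneg n : (0 : ℝ) ≤ n)]

omit [Fintype F] in
theorem pow_div_prod_eq_one_iff {N : ℕ} {y : F} (hy : y ^ N = 1) (P : Finset ℕ)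
    (hP : ∀ l ∈ P, l.Prime ∧ l ∣ N) : y ^ (N / ∏ l ∈ P, l) = 1 ↔ ∀ l ∈ P, y ^ (N / l) = 1 := by
  have hdvd : ∏ l ∈ P, l ∣ N :=
    Finset.prod_primes_dvd N (fun l hl => (hP l hl).1.prime) fun l hl => (hP l hl).2
  have ho : orderOf y ∣ N := orderOf_dvd_of_pow_eq_one hy
  have hswap {a : ℕ} (ha : a ∣ N) : y ^ (N / a) = 1 ↔ a ∣ N / orderOf y := by
    rw [← orderOf_dvd_iff_pow_eq_one, Nat.dvd_div_iff_mul_dvd ha, Nat.dvd_div_iff_mul_dvd ho,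
      mul_comm]
  rw [hswap hdvd]
  constructor
  · intro h l hl
    exact (hswap (hP l hl).2).mpr ((Finset.dvd_prod_of_mem _ hl).trans h)
  · intro h
    exact Finset.prod_primes_dvd _ (fun l hl => (hP l hl).1.prime) fun l hl =>
      (hswap (hP l hl).2).mp (h l hl)

theorem abs_card_events_sub_le [DecidableEq F] (s : κ → F) (hs : Function.Injective s)
    (S : Finset (κ × ℕ)) (hS : ∀ e ∈ S, e.2.Prime ∧ e.2 ∣ Fintype.card F - 1) (K : ℕ) (hK : 2 ≤ K)
    (hq : (∏ e ∈ S, e.2) * ((Fintype.card κ + 1) * ((∏ e ∈ S, e.2) * K) ^ 2 + Fintype.card κ) <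
      Fintype.card F) :
    |((univ.filter fun x : F => (∀ i, x + s i ≠ 0) ∧
          ∀ e ∈ S, (x + s e.1) ^ ((Fintype.card F - 1) / e.2) = 1).card : ℝ) -
        Fintype.card F * ∏ e ∈ S, (e.2 : ℝ)⁻¹| ≤
      Fintype.card κ + 2 * (Fintype.card κ + 1) * Fintype.card F / K := by
  have hq1 : 1 < Fintype.card F := Fintype.one_lt_card
  let P : κ → Finset ℕ := fun i => (S.filter fun e => e.1 = i).image Prod.snd
  let d : κ → ℕ := fun i => ∏ l ∈ P i, l
  have hP : ∀ i, ∀ l ∈ P i, l.Prime ∧ l ∣ Fintype.card F - 1 := by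
    intro i l hl
    obtain ⟨e, he, rfl⟩ := mem_image.mp hl
    exact hS e (mem_filter.mp he).1
  have hprod : ∏ i, d i = ∏ e ∈ S, e.2 := by
    rw [← Finset.prod_fiberwise S Prod.fst]
    refine Finset.prod_congr rfl fun i _ => ?_
    refine Finset.prod_image ?_
    rintro ⟨a, l⟩ ha ⟨b, l'⟩ hb h
    simp only [coe_filter, Set.mem_ofPred_eq] at ha hb h
    rw [ha.2, hb.2, h]
  have hd0 : ∀ i, d i ≠ 0 := fun i => Finset.prod_ne_zero_iff.mpr fun l hl => (hP i l hl).1.ne_zero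
  have hd : ∀ i, d i ∣ Fintype.card F - 1 := fun i =>
    Finset.prod_primes_dvd _ (fun l hl => (hP i l hl).1.prime) fun l hl => (hP i l hl).2
  have h := abs_card_sub_le s hs d hd0 hd K hK (by rw [hprod]; exact hq)
  rw [← Nat.cast_prod, hprod, Nat.cast_prod, ← Finset.prod_inv_distrib] at h
  have hdiv : ∀ i, 0 < (Fintype.card F - 1) / d i := fun i =>
    Nat.div_pos (Nat.le_of_dvd (by omega) (hd i)) (Nat.pos_of_ne_zero (hd0 i))
  suffices hset : (univ.filter fun x : F => (∀ i, x + s i ≠ 0) ∧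
      ∀ e ∈ S, (x + s e.1) ^ ((Fintype.card F - 1) / e.2) = 1) =
      univ.filter fun x : F => ∀ i, (x + s i) ^ ((Fintype.card F - 1) / d i) = 1 by
    rwa [hset]
  refine Finset.filter_congr fun x _ => ?_
  have hiff (i : κ) (hx : x + s i ≠ 0) := pow_div_prod_eq_one_iff
    (FiniteField.pow_card_sub_one_eq_one _ hx) (P i) (hP i)
  constructor
  · rintro ⟨hx, he⟩ i
    refine (hiff i (hx i)).mpr fun l hl => ?_
    obtain ⟨e, he', rfl⟩ := mem_image.mp hl
    obtain ⟨he1, rfl⟩ := mem_filter.mp he'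
    exact he e he1
  · intro hx
    have hx0 : ∀ i, x + s i ≠ 0 := by
      intro i h0
      have := hx i
      rw [h0, zero_pow (hdiv i).ne'] at this
      exact zero_ne_one this
    exact ⟨hx0, fun e he => (hiff e.1 (hx0 e.1)).mp (hx e.1) e.2
      (mem_image.mpr ⟨e, mem_filter.mpr ⟨he, rfl⟩, rfl⟩)⟩

end Equidistribution

section Sieve

variable {ι α : Type*} [DecidableEq ι]

/-- The subsets of `T` of cardinality at most `R`. -/
def smallSubsets (T : Finset ι) (R : ℕ) : Finset (Finset ι) :=
  T.powerset.filter fun S => S.card ≤ R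

omit [DecidableEq ι] in
theorem mem_smallSubsets {T S : Finset ι} {R : ℕ} :
    S ∈ smallSubsets T R ↔ S ⊆ T ∧ S.card ≤ R := by
  simp [smallSubsets]

omit [DecidableEq ι] in
theorem sum_smallSubsets_apply_card {M : Type*} [AddCommMonoid M] (f : ℕ → M) (T : Finset ι)
    (R : ℕ) : ∑ S ∈ smallSubsets T R, f S.card = ∑ k ∈ range (R + 1), T.card.choose k • f k := by
  rw [smallSubsets, Finset.sum_filter,
    Finset.sum_powerset_apply_card (fun k => if k ≤ R then f k else 0)]
  have h (a b : ℕ) (hab : a ≤ b) (g : ℕ → M) (hg : ∀ k, a ≤ k → g k = 0) :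
      ∑ k ∈ range a, g k = ∑ k ∈ range b, g k :=
    Finset.sum_subset (range_subset_range.mpr hab) fun k _ hk => hg k (by simpa using hk)
  rw [h (T.card + 1) (T.card + 1 + (R + 1)) (by omega) _ fun k hk => by
      rw [Nat.choose_eq_zero_of_lt (by omega), zero_smul],
    ← h (R + 1) (T.card + 1 + (R + 1)) (by omega) _ fun k hk => by
      rw [if_neg (by omega), smul_zero]]
  exact Finset.sum_congr rfl fun k hk => by rw [if_pos (by simpa [Nat.lt_succ_iff] using hk)]

omit [DecidableEq ι] in
theorem card_smallSubsets_le (T : Finset ι) (R : ℕ) :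
    (smallSubsets T R).card ≤ (T.card + 1) ^ R := by
  have h := sum_smallSubsets_apply_card (fun _ => (1 : ℕ)) T R
  rw [Finset.sum_const, smul_eq_mul, mul_one] at h
  rw [h, add_pow]
  refine Finset.sum_le_sum fun k hk => ?_
  have h1 : 0 < R.choose k := Nat.choose_pos (by simpa [Nat.lt_succ_iff] using hk)
  calc T.card.choose k • 1 ≤ T.card ^ k := by simpa using Nat.choose_le_pow T.card k
    _ ≤ _ := by simpa using Nat.le_mul_of_pos_right _ h1

theorem sum_smallSubsets_neg_one_pow (T : Finset ι) (R : ℕ) :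
    ∑ S ∈ smallSubsets T R, (-1 : ℝ) ^ S.card =
      if T = ∅ then 1 else (-1) ^ R * ((T.card - 1).choose R : ℝ) := by
  rw [sum_smallSubsets_apply_card]
  split_ifs with hT
  · subst hT
    rw [Finset.sum_range_succ']
    simp
  · obtain ⟨m, hm⟩ := Nat.exists_eq_succ_of_ne_zero (card_ne_zero_of_mem
      (Finset.nonempty_iff_ne_empty.mpr hT).choose_spec)
    have h := Int.alternating_sum_range_choose_eq_choose (n := m) (m := R)
    have h' := congrArg (Int.cast : ℤ → ℝ) h
    push_cast at h'
    rw [hm, Nat.succ_sub_one, ← h']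
    exact Finset.sum_congr rfl fun k _ => by rw [nsmul_eq_mul, mul_comm, Nat.succ_eq_add_one]

variable (A : ι → α → Prop)

open Classical in
/-- The number of elements of `Ω` at which all events of `S` occur. -/
noncomputable def eventCount (Ω : Finset α) (S : Finset ι) : ℕ :=
  (Ω.filter fun x => ∀ e ∈ S, A e x).card

omit [DecidableEq ι] in
open Classical in
theorem sum_smallSubsets_eventCount (Ω : Finset α) (T : Finset ι) (R : ℕ) :
    ∑ S ∈ smallSubsets T R, (-1 : ℝ) ^ S.card * eventCount A Ω S =
      ∑ x ∈ Ω, ∑ S ∈ smallSubsets (T.filter fun e => A e x) R, (-1 : ℝ) ^ S.card := by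
  have h (x : α) : smallSubsets (T.filter fun e => A e x) R =
      (smallSubsets T R).filter fun S => ∀ e ∈ S, A e x := by
    ext S
    simp only [mem_smallSubsets, mem_filter, subset_iff]
    grind
  simp_rw [h, Finset.sum_filter]
  rw [Finset.sum_comm]
  refine Finset.sum_congr rfl fun S _ => ?_
  rw [← Finset.sum_filter, Finset.sum_const, nsmul_eq_mul, mul_comm]
  rfl

open Classical in
theorem eventCount_insert (Ω : Finset α) (u : ι) (S : Finset ι) :
    eventCount A Ω (insert u S) = eventCount A (Ω.filter fun x => A u x) S := by
  rw [eventCount, eventCount, Finset.filter_filter]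
  simp

open Classical in
theorem combinatorial_sieve (Ω : Finset α) (T U B : Finset ι) {R : ℕ} (hR : Odd R) :
    ∑ S ∈ smallSubsets T R, (-1 : ℝ) ^ S.card * eventCount A Ω S -
        ∑ u ∈ U, ∑ S ∈ smallSubsets T (R + 1), (-1 : ℝ) ^ S.card * eventCount A Ω (insert u S) -
        ∑ b ∈ B, (eventCount A Ω {b} : ℝ) ≤
      ((Ω.filter fun x => ∀ e, e ∈ T ∨ e ∈ U ∨ e ∈ B → ¬ A e x).card : ℝ) := by
  simp_rw [eventCount_insert, sum_smallSubsets_eventCount, Finset.sum_filter]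
  rw [Finset.sum_comm (s := U)]
  have hB : ∑ b ∈ B, (eventCount A Ω {b} : ℝ) = ∑ x ∈ Ω, ∑ b ∈ B, if A b x then (1 : ℝ) else 0 := by
    rw [Finset.sum_comm]
    refine Finset.sum_congr rfl fun b _ => ?_
    simp [eventCount]
  rw [hB, ← Finset.sum_sub_distrib, ← Finset.sum_sub_distrib, Finset.card_filter]
  push_cast
  refine Finset.sum_le_sum fun x _ => ?_
  simp_rw [sum_smallSubsets_neg_one_pow]
  have hR1 : (-1 : ℝ) ^ (R + 1) = 1 := (hR.add_odd odd_one).neg_one_pow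
  rw [hR.neg_one_pow, hR1]
  have hU0 (c : ℝ) (hc : 0 ≤ c) : 0 ≤ ∑ u ∈ U, if A u x then c else 0 :=
    Finset.sum_nonneg fun u _ => by split_ifs <;> simp [hc]
  have hB0 : 0 ≤ ∑ b ∈ B, if A b x then (1 : ℝ) else 0 :=
    Finset.sum_nonneg fun b _ => by split_ifs <;> simp
  by_cases hT : (T.filter fun e => A e x) = ∅
  · simp only [if_pos hT]
    split_ifs with hgood
    · linarith [hU0 1 zero_le_one]
    · push Not at hgood
      obtain ⟨e, he, hAe⟩ := hgood
      have hle {V : Finset ι} (hV : e ∈ V) : (1 : ℝ) ≤ ∑ u ∈ V, if A u x then (1 : ℝ) else 0 := by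
        refine le_trans ?_ (Finset.single_le_sum (fun u _ => ?_) hV)
        · rw [if_pos hAe]
        · split_ifs <;> simp
      rcases he with he | he | he
      · exact absurd hAe (Finset.filter_eq_empty_iff.mp hT he)
      · linarith [hle he]
      · linarith [hle he, hU0 1 zero_le_one]
  · simp only [if_neg hT]
    have h1 : (0 : ℝ) ≤ if ∀ e, e ∈ T ∨ e ∈ U ∨ e ∈ B → ¬ A e x then 1 else 0 := by
      split_ifs <;> simp
    have h2 := hU0 (1 * (((T.filter fun e => A e x).card - 1).choose (R + 1) : ℝ)) (by positivity)
    have h3 : (0 : ℝ) ≤ (((T.filter fun e => A e x).card - 1).choose R : ℝ) := by positivity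
    linarith

omit [DecidableEq ι] in
theorem abs_sum_smallSubsets_sub_prod_le (T : Finset ι) (R : ℕ) (w : ι → ℝ)
    (hw : ∀ e ∈ T, 0 ≤ w e) :
    |∑ S ∈ smallSubsets T R, (-1) ^ S.card * ∏ e ∈ S, w e - ∏ e ∈ T, (1 - w e)| ≤
      (∏ e ∈ T, (1 + 2 * w e)) / 2 ^ R := by
  have h1 : ∏ e ∈ T, (1 - w e) = ∑ S ∈ T.powerset, (-1) ^ S.card * ∏ e ∈ S, w e := by
    simp_rw [sub_eq_add_neg, Finset.prod_one_add, Finset.prod_neg]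
  have h2 : ∏ e ∈ T, (1 + 2 * w e) = ∑ S ∈ T.powerset, 2 ^ S.card * ∏ e ∈ S, w e := by
    simp_rw [Finset.prod_one_add, Finset.prod_mul_distrib, Finset.prod_const]
  rw [h1, smallSubsets, ← Finset.sum_filter_add_sum_filter_not T.powerset fun S => S.card ≤ R,
    sub_add_cancel_left, abs_neg, h2, Finset.sum_div]
  refine (Finset.abs_sum_le_sum_abs _ _).trans ?_
  have hpos {S : Finset ι} (hS : S ∈ T.powerset) : 0 ≤ ∏ e ∈ S, w e :=
    Finset.prod_nonneg fun e he => hw e (mem_powerset.mp hS he)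
  refine (Finset.sum_le_sum fun S hS => ?_).trans (Finset.sum_le_sum_of_subset_of_nonneg
    (filter_subset _ _) fun S hS _ => div_nonneg (mul_nonneg (by positivity) (hpos hS))
      (by positivity))
  obtain ⟨hS1, hS2⟩ := mem_filter.mp hS
  rw [abs_mul, abs_pow, abs_neg, abs_one, one_pow, one_mul, abs_of_nonneg (hpos hS1),
    le_div_iff₀ (by positivity), mul_comm]
  exact mul_le_mul_of_nonneg_right (pow_le_pow_right₀ one_le_two (by omega)) (hpos hS1)

open Classical in
theorem sieve_lower_bound (Ω : Finset α) (T U B : Finset ι) (hTU : Disjoint T U) {R : ℕ}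
    (hR : Odd R) (w : ι → ℝ) (X E : ℝ)
    (hT : ∀ S ∈ smallSubsets T R, |eventCount A Ω S - X * ∏ e ∈ S, w e| ≤ E)
    (hU : ∀ u ∈ U, ∀ S ∈ smallSubsets T (R + 1),
      |eventCount A Ω (insert u S) - X * ∏ e ∈ insert u S, w e| ≤ E) :
    X * (∑ S ∈ smallSubsets T R, (-1) ^ S.card * ∏ e ∈ S, w e -
        (∑ u ∈ U, w u) * ∑ S ∈ smallSubsets T (R + 1), (-1) ^ S.card * ∏ e ∈ S, w e) -
        E * ((smallSubsets T R).card + U.card * (smallSubsets T (R + 1)).card) -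
        ∑ b ∈ B, (eventCount A Ω {b} : ℝ) ≤
      ((Ω.filter fun x => ∀ e, e ∈ T ∨ e ∈ U ∨ e ∈ B → ¬ A e x).card : ℝ) := by
  refine le_trans ?_ (combinatorial_sieve A Ω T U B hR)
  have hsign (k : ℕ) (a b : ℝ) (hab : |a - b| ≤ E) : |(-1) ^ k * a - (-1) ^ k * b| ≤ E := by
    rwa [← mul_sub, abs_mul, abs_pow, abs_neg, abs_one, one_pow, one_mul]
  have h1 : X * ∑ S ∈ smallSubsets T R, (-1) ^ S.card * ∏ e ∈ S, w e -
      E * (smallSubsets T R).card ≤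
      ∑ S ∈ smallSubsets T R, (-1 : ℝ) ^ S.card * eventCount A Ω S := by
    rw [Finset.mul_sum, mul_comm E, ← nsmul_eq_mul, ← Finset.sum_const, ← Finset.sum_sub_distrib]
    refine Finset.sum_le_sum fun S hS => ?_
    have := (abs_le.mp (hsign S.card _ _ (hT S hS))).1
    linarith
  have h2 : ∑ u ∈ U, ∑ S ∈ smallSubsets T (R + 1), (-1 : ℝ) ^ S.card * eventCount A Ω (insert u S) ≤
      X * ((∑ u ∈ U, w u) * ∑ S ∈ smallSubsets T (R + 1), (-1) ^ S.card * ∏ e ∈ S, w e) +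
      E * (U.card * (smallSubsets T (R + 1)).card) := by
    rw [Finset.sum_mul, Finset.mul_sum, mul_left_comm E, ← nsmul_eq_mul, ← Finset.sum_const,
      ← Finset.sum_add_distrib]
    refine Finset.sum_le_sum fun u hu => ?_
    rw [mul_comm E, ← nsmul_eq_mul, ← Finset.sum_const, Finset.mul_sum, Finset.mul_sum,
      ← Finset.sum_add_distrib]
    refine Finset.sum_le_sum fun S hS => ?_
    have := (abs_le.mp (hsign S.card _ _ (hU u hu S hS))).2
    rw [Finset.prod_insert fun h =>
      Finset.disjoint_left.mp hTU ((mem_smallSubsets.mp hS).1 h) hu] at this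
    linarith
  linarith

end Sieve

section PrimitiveShifts

theorem inv_le_prod_one_sub_inv {z : ℕ} (hz : 1 ≤ z) (P : Finset ℕ) (hP : ∀ l ∈ P, 2 ≤ l ∧ l ≤ z) :
    (z : ℝ)⁻¹ ≤ ∏ l ∈ P, (1 - (l : ℝ)⁻¹) := by
  have h : ∏ l ∈ Icc 2 z, (1 - (l : ℝ)⁻¹) = (z : ℝ)⁻¹ := by
    clear hP
    induction z, hz using Nat.le_induction with
    | base => simp
    | succ z hz ih =>
      have hz1 : (z : ℝ) + 1 ≠ 0 := by positivity
      rw [Finset.prod_Icc_succ_top (by omega), ih]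
      push_cast
      field_simp
      ring
  have hinv (l : ℕ) : (l : ℝ)⁻¹ ≤ 1 := Nat.cast_inv_le_one l
  rw [← h]
  exact Finset.prod_le_prod_of_subset_of_le_one (fun l hl => by simpa using hP l hl)
    (fun l _ => by linarith [hinv l]) fun l _ _ => by simp

theorem prod_one_add_two_mul_inv_le {z : ℕ} (hz : 1 ≤ z) (P : Finset ℕ)
    (hP : ∀ l ∈ P, 2 ≤ l ∧ l ≤ z) : ∏ l ∈ P, (1 + 2 * (l : ℝ)⁻¹) ≤ (z : ℝ) ^ 2 := by
  have h : ∏ l ∈ Icc 2 z, (1 + (l : ℝ)⁻¹) = (z + 1) / 2 := by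
    clear hP
    induction z, hz using Nat.le_induction with
    | base => norm_num
    | succ z hz ih =>
      have hz1 : (z : ℝ) + 1 ≠ 0 := by positivity
      rw [Finset.prod_Icc_succ_top (by omega), ih]
      push_cast
      field_simp
  have hzR : (1 : ℝ) ≤ z := by exact_mod_cast hz
  calc ∏ l ∈ P, (1 + 2 * (l : ℝ)⁻¹) ≤ ∏ l ∈ P, (1 + (l : ℝ)⁻¹) ^ 2 :=
        Finset.prod_le_prod (fun l _ => by positivity) fun l _ => by nlinarith [sq_nonneg (l : ℝ)⁻¹]
    _ ≤ ∏ l ∈ Icc 2 z, (1 + (l : ℝ)⁻¹) ^ 2 :=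
        Finset.prod_le_prod_of_subset_of_one_le (fun l hl => by simpa using hP l hl)
          (fun l _ => by positivity) fun l _ _ => one_le_pow₀ (by simp)
    _ = ((z + 1) / 2) ^ 2 := by rw [Finset.prod_pow, h]
    _ ≤ (z : ℝ) ^ 2 := by gcongr; linarith

theorem sieve_parameter_bound {q n z R D K : ℕ} (hz : 8 * n ≤ z) (hn : 1 ≤ n)
    (hK : K = z ^ (R + n + 4)) (hD : D ≤ z ^ (R + n + 2)) (hq : z ^ (5 * R + 5 * n + 15) ≤ q) :
    D * ((n + 1) * (D * K) ^ 2 + n) < q := by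
  have hz0 : 0 < z := by omega
  refine lt_of_lt_of_le ?_ hq
  set D' := z ^ (R + n + 2) with hD'
  have hK1 : 0 < D' * K := by rw [hK, hD']; positivity
  calc D * ((n + 1) * (D * K) ^ 2 + n) ≤ D' * ((n + 1) * (D' * K) ^ 2 + n) := by gcongr
    _ ≤ D' * ((n + 1) * (D' * K) ^ 2 + n * (D' * K) ^ 2) := by
        gcongr
        exact Nat.le_mul_of_pos_right _ (by positivity)
    _ = D' * (D' * K) ^ 2 * (2 * n + 1) := by ring
    _ < D' * (D' * K) ^ 2 * z := by
        refine Nat.mul_lt_mul_of_pos_left (by omega) ?_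
        rw [hD']
        positivity
    _ = z ^ (5 * R + 5 * n + 15) := by rw [hK, hD']; ring

theorem card_filter_add_pow_eq_one_le {F : Type*} [Field F] [DecidableEq F] (Ω : Finset F) (a : F)
    {m : ℕ} (hm : 0 < m) : (Ω.filter fun x => (x + a) ^ m = 1).card ≤ m := by
  have h1 : (Ω.filter fun x => (x + a) ^ m = 1).card ≤ (nthRootsFinset m (1 : F)).card := by
    refine Finset.card_le_card_of_injOn (· + a) (fun x hx => ?_) (add_left_injective a).injOn
    exact (mem_nthRootsFinset hm _).mpr (mem_filter.mp hx).2
  refine h1.trans ?_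
  classical
  rw [nthRootsFinset_def]
  exact (Multiset.toFinset_card_le _).trans (card_nthRoots _ _)

theorem sieve_error_bound {z n q K a b c g : ℝ} {R m : ℕ} (hz : 64 ≤ z) (hn : 1 ≤ n)
    (hzn : 8 * n ≤ z) (hKq : K ≤ q) (hK : K = z ^ (R + m + 4)) (ha : a ≤ z ^ R) (hb : 8 * b ≤ z)
    (hc : c ≤ z ^ (R + 1)) (hg : g = (z ^ m)⁻¹) (ha0 : 0 ≤ a) (hc0 : 0 ≤ c) :
    (n + 2 * (n + 1) * q / K) * (a + b * c) ≤ q * g / 64 := by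
  have hz0 : 0 < z := by linarith
  have hK0 : 0 < K := by rw [hK]; positivity
  have hq0 : 0 < q := hK0.trans_le hKq
  have h1 : a + b * c ≤ z ^ (R + 2) := by
    have h2 : b * c ≤ z / 8 * z ^ (R + 1) := by
      refine (mul_le_mul_of_nonneg_right (by linarith : b ≤ z / 8) hc0).trans ?_
      gcongr
    have h3 : z ^ R ≤ 1 / 2 * z ^ (R + 2) := by
      have h4 : 2 ≤ z ^ 2 := by nlinarith
      rw [pow_add]
      nlinarith [pow_pos hz0 R]
    have h4 : z / 8 * z ^ (R + 1) = 1 / 8 * z ^ (R + 2) := by ring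
    have h6 := pow_pos hz0 (R + 2)
    linarith
  have h7 : n + 2 * (n + 1) * q / K ≤ z * q / K := by
    rw [le_div_iff₀ hK0, add_mul, div_mul_cancel₀ _ hK0.ne']
    nlinarith
  calc _ ≤ (n + 2 * (n + 1) * q / K) * z ^ (R + 2) := by gcongr
    _ ≤ z * q / K * z ^ (R + 2) := by gcongr
    _ = q * g / z := by
      rw [hg, hK]
      field_simp
      ring
    _ ≤ q * g / 64 := by
      have : 0 ≤ g := by rw [hg]; positivity
      gcongr

theorem exists_add_pow_ne_one {F : Type u} {κ : Type*} [Field F] [Fintype F] [Fintype κ]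
    [DecidableEq κ] [Nonempty κ] (s : κ → F) (hs : Function.Injective s) (z R : ℕ) (hz : 64 ≤ z)
    (hzn : 8 * Fintype.card κ ≤ z)
    (hzω : 8 * (Fintype.card κ * (Fintype.card F - 1).primeFactors.card) < z)
    (hR : Odd R) (hzR : 8 * z ^ (3 * Fintype.card κ) ≤ 2 ^ R)
    (hq : z ^ (5 * R + 5 * Fintype.card κ + 15) ≤ Fintype.card F) :
    ∃ x : F, ∀ i, x + s i ≠ 0 ∧ ∀ l ∈ (Fintype.card F - 1).primeFactors,
      (x + s i) ^ ((Fintype.card F - 1) / l) ≠ 1 := by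
  classical
  have hn : 1 ≤ Fintype.card κ := Fintype.card_pos
  set n := Fintype.card κ with hndef
  set q := Fintype.card F with hqdef
  have hq1 : 1 < q := Fintype.one_lt_card
  set P := (q - 1).primeFactors with hPdef
  have hPp : ∀ l ∈ P, l.Prime ∧ l ∣ q - 1 := fun l hl =>
    ⟨Nat.prime_of_mem_primeFactors hl, Nat.dvd_of_mem_primeFactors hl⟩
  let P₁ := P.filter fun l => l ≤ z
  let P₂ := P.filter fun l => z < l ∧ l ≤ z ^ (n + 1)
  let P₃ := P.filter fun l => z ^ (n + 1) < l
  let T : Finset (κ × ℕ) := univ ×ˢ P₁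
  let U : Finset (κ × ℕ) := univ ×ˢ P₂
  let B : Finset (κ × ℕ) := univ ×ˢ P₃
  have hcard {P' : Finset ℕ} (h : P' ⊆ P) : 8 * (univ ×ˢ P' : Finset (κ × ℕ)).card < z := by
    refine lt_of_le_of_lt ?_ hzω
    rw [card_product, card_univ]
    exact Nat.mul_le_mul_left _ (Nat.mul_le_mul_left _ (card_le_card h))
  have hTc : 8 * T.card < z := hcard (filter_subset _ _)
  have hUc : 8 * U.card < z := hcard (filter_subset _ _)
  have hBc : 8 * B.card < z := hcard (filter_subset _ _)
  have hTm : ∀ e ∈ T, e.2 ∈ P ∧ e.2 ≤ z := fun e he => by simpa [T, P₁] using he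
  have hUm : ∀ e ∈ U, e.2 ∈ P ∧ z < e.2 ∧ e.2 ≤ z ^ (n + 1) := fun e he => by
    simpa [U, P₂] using he
  have hBm : ∀ e ∈ B, e.2 ∈ P ∧ z ^ (n + 1) < e.2 := fun e he => by simpa [B, P₃] using he
  have hTU : Disjoint T U := Finset.disjoint_left.mpr fun e h1 h2 => by
    have := (hTm e h1).2
    have := (hUm e h2).2.1
    omega
  let A : κ × ℕ → F → Prop := fun e x => (x + s e.1) ^ ((q - 1) / e.2) = 1
  let Ω : Finset F := univ.filter fun x => ∀ i, x + s i ≠ 0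
  let w : κ × ℕ → ℝ := fun e => (e.2 : ℝ)⁻¹
  obtain ⟨K, hK⟩ : ∃ K, K = z ^ (R + n + 4) := ⟨_, rfl⟩
  have hK2 : 2 ≤ K := by
    rw [hK]
    exact (show 2 ≤ z by omega).trans (Nat.le_self_pow (by omega) z)
  have hKq : K ≤ q := by
    rw [hK]
    exact (Nat.pow_le_pow_right (by omega) (by omega)).trans hq
  have hev (S : Finset (κ × ℕ)) (hS : ∀ e ∈ S, e.2 ∈ P) (hD : ∏ e ∈ S, e.2 ≤ z ^ (R + n + 2)) :
      |eventCount A Ω S - (q : ℝ) * ∏ e ∈ S, w e| ≤ n + 2 * (n + 1) * q / K := by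
    have := abs_card_events_sub_le s hs S (fun e he => hPp _ (hS e he)) K hK2
      (sieve_parameter_bound hzn hn hK hD hq)
    convert this using 5
    simp only [eventCount, Ω, A, Finset.filter_filter]
    congr!
  have hpow {S : Finset (κ × ℕ)} {k : ℕ} (hS : S ∈ smallSubsets T k) :
      ∏ e ∈ S, e.2 ≤ z ^ k := by
    obtain ⟨h1, h2⟩ := mem_smallSubsets.mp hS
    exact (Finset.prod_le_pow_card S _ z fun e he => (hTm e (h1 he)).2).trans
      (Nat.pow_le_pow_right (by omega) h2)
  have hsieve := sieve_lower_bound A Ω T U B hTU hR w q (n + 2 * (n + 1) * q / K)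
    (fun S hS => hev S (fun e he => (hTm e ((mem_smallSubsets.mp hS).1 he)).1)
      ((hpow hS).trans (Nat.pow_le_pow_right (by omega) (by omega))))
    (fun u hu S hS => hev _
      (fun e he => by
        rcases mem_insert.mp he with rfl | he
        · exact (hUm _ hu).1
        · exact (hTm e ((mem_smallSubsets.mp hS).1 he)).1)
      (by
        rw [Finset.prod_insert fun h =>
          Finset.disjoint_left.mp hTU ((mem_smallSubsets.mp hS).1 h) hu]
        refine (Nat.mul_le_mul (hUm u hu).2.2 (hpow hS)).trans ?_
        rw [← pow_add]
        exact Nat.pow_le_pow_right (by omega) (by omega)))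
  have hzR0 : (64 : ℝ) ≤ z := by exact_mod_cast hz
  have hz0 : (0 : ℝ) < z := by linarith
  have hqR : (0 : ℝ) < q := by exact_mod_cast (by omega : 0 < q)
  obtain ⟨g, hg⟩ : ∃ g : ℝ, g = ((z : ℝ) ^ n)⁻¹ := ⟨_, rfl⟩
  have hg0 : 0 < g := by rw [hg]; positivity
  have hP₁ : ∀ l ∈ P₁, 2 ≤ l ∧ l ≤ z := fun l hl =>
    ⟨(hPp l (mem_filter.mp hl).1).1.two_le, (mem_filter.mp hl).2⟩
  have hG : g ≤ ∏ e ∈ T, (1 - w e) := by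
    rw [Finset.prod_product]
    simp only [w]
    rw [Finset.prod_const, card_univ, hg, ← inv_pow]
    exact pow_le_pow_left₀ (by positivity) (inv_le_prod_one_sub_inv (by omega) P₁ hP₁) _
  have hrankin : ∏ e ∈ T, (1 + 2 * w e) ≤ (z : ℝ) ^ (2 * n) := by
    rw [Finset.prod_product]
    simp only [w]
    rw [Finset.prod_const, card_univ, pow_mul]
    exact pow_le_pow_left₀ (Finset.prod_nonneg fun l _ => by positivity)
      (prod_one_add_two_mul_inv_le (by omega) P₁ hP₁) _
  have htail (k : ℕ) (hk : R ≤ k) : (∏ e ∈ T, (1 + 2 * w e)) / 2 ^ k ≤ g / 8 := by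
    have h1 : (8 : ℝ) * z ^ (3 * n) ≤ 2 ^ k := by
      have : (8 : ℝ) * z ^ (3 * n) ≤ 2 ^ R := by exact_mod_cast hzR
      exact this.trans (pow_le_pow_right₀ one_le_two hk)
    rw [div_le_iff₀ (by positivity)]
    calc _ ≤ (z : ℝ) ^ (2 * n) := hrankin
      _ = g / 8 * (8 * z ^ (3 * n)) := by
        rw [hg]
        field_simp
        ring
      _ ≤ g / 8 * 2 ^ k := by gcongr
  have hw0 : ∀ e, 0 ≤ w e := fun e => by positivity
  have hmain₁ := (abs_le.mp ((abs_sum_smallSubsets_sub_prod_le T R w fun e _ => hw0 e).trans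
    (htail R le_rfl))).1
  have hmain₂ := (abs_le.mp ((abs_sum_smallSubsets_sub_prod_le T (R + 1) w fun e _ => hw0 e).trans
    (htail (R + 1) (by omega)))).2
  have hW0 : 0 ≤ ∑ u ∈ U, w u := Finset.sum_nonneg fun e _ => hw0 e
  have hUcR : 8 * (U.card : ℝ) ≤ z := by exact_mod_cast hUc.le
  have hW : ∑ u ∈ U, w u ≤ 1 / 8 := by
    have h1 : ∑ u ∈ U, w u ≤ U.card • (z : ℝ)⁻¹ := Finset.sum_le_card_nsmul _ _ _ fun u hu =>
      inv_anti₀ hz0 (by exact_mod_cast (hUm u hu).2.1.le)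
    rw [nsmul_eq_mul, ← div_eq_mul_inv] at h1
    refine h1.trans ?_
    rw [div_le_iff₀ hz0]
    linarith
  set G := ∏ e ∈ T, (1 - w e)
  set S₁ := ∑ S ∈ smallSubsets T R, (-1 : ℝ) ^ S.card * ∏ e ∈ S, w e
  set S₂ := ∑ S ∈ smallSubsets T (R + 1), (-1 : ℝ) ^ S.card * ∏ e ∈ S, w e
  set W := ∑ u ∈ U, w u
  have hmain : g / 2 ≤ S₁ - W * S₂ := by
    have h1 : W * S₂ ≤ 1 / 8 * (G + g / 8) :=
      (mul_le_mul_of_nonneg_left (by linarith : S₂ ≤ G + g / 8) hW0).trans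
        (mul_le_mul_of_nonneg_right hW (by linarith))
    linarith
  have herr : ((n : ℝ) + 2 * (n + 1) * q / K) *
      ((smallSubsets T R).card + U.card * (smallSubsets T (R + 1)).card) ≤ q * g / 64 := by
    have hc (k : ℕ) : ((smallSubsets T k).card : ℝ) ≤ (z : ℝ) ^ k := by
      exact_mod_cast (card_smallSubsets_le T k).trans (Nat.pow_le_pow_left (by omega) k)
    exact sieve_error_bound hzR0 (by exact_mod_cast hn) (by exact_mod_cast hzn)
      (by exact_mod_cast hKq) (by exact_mod_cast hK) (hc R) hUcR (hc (R + 1)) hg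
      (Nat.cast_nonneg _) (Nat.cast_nonneg _)
  have hbig : ∑ b ∈ B, (eventCount A Ω {b} : ℝ) ≤ q * g / 8 := by
    have h1 : ∀ b ∈ B, (eventCount A Ω {b} : ℝ) ≤ q / (z : ℝ) ^ (n + 1) := by
      intro b hb
      have hb' := hPp _ (hBm b hb).1
      have hb0 := hb'.1.pos
      have h2 : eventCount A Ω {b} ≤ (q - 1) / b.2 := by
        refine le_trans (le_of_eq ?_) (card_filter_add_pow_eq_one_le Ω (s b.1)
          (Nat.div_pos (Nat.le_of_dvd (by omega) hb'.2) hb0))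
        simp [eventCount, A]
      calc (eventCount A Ω {b} : ℝ) ≤ (((q - 1) / b.2 : ℕ) : ℝ) := by exact_mod_cast h2
        _ ≤ ((q - 1 : ℕ) : ℝ) / (b.2 : ℝ) := Nat.cast_div_le
        _ ≤ q / (z : ℝ) ^ (n + 1) := by
          gcongr
          · omega
          · exact_mod_cast (hBm b hb).2.le
    refine (Finset.sum_le_card_nsmul _ _ _ h1).trans ?_
    rw [nsmul_eq_mul]
    have hBcR : (B.card : ℝ) ≤ z / 8 := by
      have : 8 * (B.card : ℝ) ≤ z := by exact_mod_cast hBc.le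
      linarith
    calc (B.card : ℝ) * (q / (z : ℝ) ^ (n + 1)) ≤ z / 8 * (q / (z : ℝ) ^ (n + 1)) := by gcongr
      _ = q * g / 8 := by
        rw [hg]
        field_simp
        ring
  have hpos : 0 < (Ω.filter fun x => ∀ e, e ∈ T ∨ e ∈ U ∨ e ∈ B → ¬ A e x).card := by
    have h1 : (q : ℝ) * (g / 2) ≤ q * (S₁ - W * S₂) := mul_le_mul_of_nonneg_left hmain hqR.le
    have h2 : 0 < (q : ℝ) * g := mul_pos hqR hg0
    have h3 := lt_of_lt_of_le (by linarith : (0 : ℝ) < _) hsieve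
    exact_mod_cast h3
  obtain ⟨x, hx⟩ := card_pos.mp hpos
  obtain ⟨hxΩ, hx⟩ := mem_filter.mp hx
  refine ⟨x, fun i => ⟨(mem_filter.mp hxΩ).2 i, fun l hl => hx (i, l) ?_⟩⟩
  by_cases h1 : l ≤ z
  · exact Or.inl (by simp [T, P₁, hl, h1])
  · by_cases h2 : l ≤ z ^ (n + 1)
    · exact Or.inr (Or.inl (by simp [U, P₂, hl, h2, not_le.mp h1]))
    · exact Or.inr (Or.inr (by simp [B, P₃, hl, not_le.mp h2]))

theorem isPrimitiveElem_of_pow_ne_one {F : Type*} [Field F] [Fintype F] {g : F} (hg : g ≠ 0)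
    (h : ∀ l ∈ (Fintype.card F - 1).primeFactors, g ^ ((Fintype.card F - 1) / l) ≠ 1) :
    IsPrimitiveElem g := by
  classical
  intro x hx
  have hq1 : 1 < Fintype.card F := Fintype.one_lt_card
  let u : Fˣ := Units.mk0 g hg
  have ho : orderOf u = Nat.card Fˣ := by
    rw [Nat.card_eq_fintype_card, Fintype.card_units]
    refine orderOf_eq_of_pow_and_pow_div_prime (by omega) ?_ fun l hl hd h1 => ?_
    · exact Units.ext (by simpa [u] using FiniteField.pow_card_sub_one_eq_one g hg)
    · refine h l (Nat.mem_primeFactors.mpr ⟨hl, hd, by omega⟩) ?_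
      simpa [u] using congrArg Units.val h1
  have htop := Subgroup.eq_top_of_card_eq (Subgroup.zpowers u) (by rw [Nat.card_zpowers, ho])
  obtain ⟨k, hk⟩ := mem_powers_iff_mem_zpowers.mpr
    (htop ▸ Subgroup.mem_top (Units.mk0 x hx) : Units.mk0 x hx ∈ Subgroup.zpowers u)
  exact ⟨k, by simpa [u] using congrArg Units.val hk⟩

theorem card_primeFactors_le_log {m : ℕ} (hm : m ≠ 0) : m.primeFactors.card ≤ Nat.log 2 m := by
  refine Nat.le_log_of_pow_le one_lt_two ?_
  refine (Finset.pow_card_le_prod _ (fun l => l) _ fun l hl =>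
    (Nat.prime_of_mem_primeFactors hl).two_le).trans ?_
  exact Nat.le_of_dvd (Nat.pos_of_ne_zero hm) (Nat.prod_primeFactors_dvd m)

theorem two_pow_le_log_of_exp_lt {n q : ℕ} (hn : 11 ≤ n)
    (hq : Real.exp ((2 : ℝ) ^ ((2.77 : ℝ) * n)) < q) : 2 ^ (2 * n + 8) ≤ Nat.log 2 q := by
  have hq0 : (0 : ℝ) < q := (Real.exp_pos _).trans hq
  have h1 : ((2 : ℝ) ^ (2 * n + 8) : ℝ) ≤ (2 : ℝ) ^ ((2.77 : ℝ) * n) := by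
    rw [← Real.rpow_natCast]
    refine Real.rpow_le_rpow_of_exponent_le one_le_two ?_
    have : (11 : ℝ) ≤ n := by exact_mod_cast hn
    push_cast
    linarith
  have h2 : (2 : ℝ) ^ ((2.77 : ℝ) * n) < Real.log q := (Real.lt_log_iff_exp_lt hq0).mpr hq
  have h3 : Real.log q < (Nat.log 2 q + 1 : ℕ) := by
    have h4 : (q : ℝ) < 2 ^ (Nat.log 2 q + 1) := by
      exact_mod_cast Nat.lt_pow_succ_log_self one_lt_two q
    refine (Real.log_lt_log hq0 h4).trans_le ?_
    rw [Real.log_pow]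
    exact mul_le_of_le_one_right (Nat.cast_nonneg _) (Real.log_two_lt_d9.le.trans (by norm_num))
  have h5 : 2 ^ (2 * n + 8) < Nat.log 2 q + 1 := by
    exact_mod_cast h1.trans_lt (h2.trans h3)
  omega

theorem cubic_le_two_pow {t : ℕ} (ht : 30 ≤ t) : 40 * t ^ 3 + 5 * t ^ 2 + 60 * t ≤ 2 ^ t := by
  induction t, ht using Nat.le_induction with
  | base => norm_num
  | succ t ht ih =>
    rw [pow_succ 2]
    have h1 : 30 * t ^ 2 ≤ t ^ 3 := by
      rw [pow_succ t 2, mul_comm]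
      exact Nat.mul_le_mul_left _ ht
    nlinarith

end PrimitiveShifts

end ConsecutivePrimitives

/-- For `n ≥ 11` and `q` a prime power of characteristic `p ≥ n` with
`q > exp(2^{2.77 n})`, the field `𝔽_q` contains `n` consecutive primitive elements. -/
theorem consecutive_primitives_of_large_q (n q p : ℕ) (hn : 11 ≤ n) (hq : IsPrimePow q)
    (F : Type*) [Field F] [Fintype F] (hF : Fintype.card F = q) (hp : CharP F p)
    (hpn : n ≤ p) (hbig : (q : ℝ) > Real.exp ((2 : ℝ) ^ ((2.77 : ℝ) * n))) :
    HasConsecutivePrimitives F n := by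
  have hinj : ∀ i < n, ∀ j < n, (i : F) = j → i = j := fun i hi j hj h =>
    CharP.natCast_injOn_Iio F p (Set.mem_Iio.mpr (hi.trans_le hpn))
      (Set.mem_Iio.mpr (hj.trans_le hpn)) h
  set L := Nat.log 2 q with hL
  have hnL : 2 ^ (2 * n + 8) ≤ L := two_pow_le_log_of_exp_lt hn hbig
  have hL0 : L ≠ 0 := fun h => by
    rw [h] at hnL
    exact absurd hnL (not_le.mpr (by positivity))
  have hq0 : q ≠ 0 := fun h => hL0 (by rw [hL, h, Nat.log_zero_right])
  have hq1 : 1 < q := by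
    by_contra h
    exact hL0 (Nat.log_of_lt (by omega))
  set t := Nat.log 2 L with ht
  have hnt : 2 * n + 8 ≤ t := Nat.le_log_of_pow_le one_lt_two hnL
  have htL : 2 ^ t ≤ L := Nat.pow_log_le_self 2 hL0
  have hLt : L < 2 ^ (t + 1) := Nat.lt_pow_succ_log_self one_lt_two L
  have hn2 : 32 * n ≤ 2 ^ t := by
    calc 32 * n ≤ 2 ^ 5 * 2 ^ n := Nat.mul_le_mul_left _ Nat.lt_two_pow_self.le
      _ = 2 ^ (5 + n) := (pow_add 2 5 n).symm
      _ ≤ 2 ^ t := Nat.pow_le_pow_right two_pos (by omega)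
  have hz : 2 ^ (2 * t) = 2 ^ t * 2 ^ t := by rw [two_mul, pow_add]
  have hω : (q - 1).primeFactors.card ≤ L :=
    (card_primeFactors_le_log (by omega)).trans (Nat.log_mono_right (Nat.sub_le q 1))
  have : Nonempty (Fin n) := ⟨⟨0, by omega⟩⟩
  obtain ⟨x, hx⟩ := exists_add_pow_ne_one (fun i : Fin n => ((i : ℕ) : F))
    (fun i j h => Fin.ext (hinj i i.2 j j.2 h)) (2 ^ (2 * t)) (2 * (4 * n * t) + 3)
    (by rw [hz]; nlinarith)
    (by rw [hz, Fintype.card_fin]; nlinarith)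
    (by
      rw [hz, Fintype.card_fin, hF]
      rw [pow_succ] at hLt
      calc 8 * (n * (q - 1).primeFactors.card) ≤ 8 * (n * L) := by gcongr
        _ < 8 * (n * (2 ^ t * 2)) := by gcongr
        _ = (16 * n) * 2 ^ t := by ring
        _ ≤ 2 ^ t * 2 ^ t := by gcongr; omega)
    ⟨4 * n * t + 1, by ring⟩
    (by
      rw [Fintype.card_fin, ← pow_mul, show 8 = 2 ^ 3 from rfl, ← pow_add]
      exact Nat.pow_le_pow_right two_pos (by nlinarith))
    (by
      rw [Fintype.card_fin, ← pow_mul, hF]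
      refine (Nat.pow_le_pow_right two_pos ?_).trans (Nat.pow_log_le_self 2 hq0)
      refine le_trans ?_ ((cubic_le_two_pow (by omega : 30 ≤ t)).trans htL)
      have h1 : 2 * n ≤ t := by omega
      calc 2 * t * (5 * (2 * (4 * n * t) + 3) + 5 * n + 15)
          = 40 * t ^ 2 * (2 * n) + 5 * t * (2 * n) + 60 * t := by ring
        _ ≤ 40 * t ^ 2 * t + 5 * t * t + 60 * t := by gcongr
        _ = 40 * t ^ 3 + 5 * t ^ 2 + 60 * t := by ring)
  refine ⟨x, fun k hk => ?_, fun i hi j hj h => hinj i hi j hj (add_left_cancel h)⟩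
  obtain ⟨h1, h2⟩ := hx ⟨k, hk⟩
  exact isPrimitiveElem_of_pow_ne_one h1 h2
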